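/- (Theorem 4: accuracy of M inherited from W^s and W^f.) Let x₁,…,xₙ ∈ ℝ be nodes, fix an index i, let m, w ∈ ℝⁿ, let P, Q, R ≥ 1 be natural numbers, and let A = m wᵀ + w mᵀ. Assume condition B_R holds (⟨w, x^(p)⟩ = p (x_i)^{p−1} for all 0 ≤ p ≤ R, interpreted as 0 when p = 0) and condition C_{P,Q} holds (⟨x^(q), A x^(p)⟩ = (p+q)(x_i)^{p+q−1} for all 0 ≤ p ≤ P, 0 ≤ q ≤ Q, interpreted as 0 when p + q = 0). Then condition A_S holds with S = min(max(P, Q), R): ⟨m, x^(p)⟩ = (x_i)^p for all 0 ≤ p ≤ min(max(P, Q), R). -/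

import Mathlib

open Matrix

/-- The bilinear form of the symmetrized outer product `m wᵀ + w mᵀ`. -/
theorem dotProduct_vecMulVec_add_vecMulVec_mulVec {ι R : Type*} [Fintype ι] [CommRing R]
    (m w u v : ι → R) :
    u ⬝ᵥ (vecMulVec m w + vecMulVec w m).mulVec v =
      (m ⬝ᵥ u) * (w ⬝ᵥ v) + (w ⬝ᵥ u) * (m ⬝ᵥ v) := by
  rw [dotProduct_comm]
  simp [add_mulVec, vecMulVec_mulVec, add_dotProduct, mul_comm]

/-- Theorem 4: accuracy of `M` inherited from `W^s` and `W^f`.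
If `P, Q, R ≥ 1`, `A = m wᵀ + w mᵀ`, condition `B_R` holds for `w`, and condition
`C_{P,Q}` holds for `A`, then condition `A_S` holds for `m` with
`S = min (max P Q) R`. -/
theorem accuracy_avg_from_source_flux (n : ℕ) (x : Fin n → ℝ) (i : Fin n)
    (m w : Fin n → ℝ) (P Q R : ℕ) (hP : 1 ≤ P) (hQ : 1 ≤ Q) (hR : 1 ≤ R)
    (A : Matrix (Fin n) (Fin n) ℝ)
    (hAdef : A = vecMulVec m w + vecMulVec w m)
    (hBR : ∀ p : ℕ, p ≤ R → (w ⬝ᵥ fun j => (x j) ^ p) = (p : ℝ) * (x i) ^ (p - 1))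
    (hC : ∀ p q : ℕ, p ≤ P → q ≤ Q →
      ((fun j => (x j) ^ q) ⬝ᵥ A.mulVec (fun j => (x j) ^ p)) =
        ((p + q : ℕ) : ℝ) * (x i) ^ (p + q - 1)) :
    ∀ p : ℕ, p ≤ min (max P Q) R → (m ⬝ᵥ fun j => (x j) ^ p) = (x i) ^ p := by
  subst hAdef
  simp only [dotProduct_vecMulVec_add_vecMulVec_mulVec] at hC
  have w_zero := hBR 0 (Nat.zero_le R)
  have w_one := hBR 1 hR
  have m_zero := hC 1 0 hP (Nat.zero_le Q)
  have m_one := hC 1 1 hP hQ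
  rw [w_zero, w_one] at m_zero
  rw [w_one] at m_one
  norm_num at m_zero m_one
  replace m_one : (m ⬝ᵥ fun j => (x j) ^ 1) = x i := by
    simp only [pow_one]
    linarith
  intro p hp
  obtain ⟨hpPQ, hpR⟩ := le_min_iff.mp hp
  cases p with
  | zero => simpa using m_zero
  | succ k =>
    have hw := hBR (k + 1) hpR
    rcases le_max_iff.mp hpPQ with hpP | hpQ
    · have h := hC (k + 1) 1 hpP hQ
      rw [hw, w_one, m_one] at h
      simp only [Nat.add_sub_cancel] at h
      push_cast at h
      linear_combination h
    · have h := hC 1 (k + 1) hP hpQ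
      rw [hw, w_one, m_one, Nat.add_comm 1 (k + 1)] at h
      simp only [Nat.add_sub_cancel] at h
      push_cast at h
      linear_combination h
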